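/- (π-method inclusion sets, Theorem 1.2) For every ε ≥ 0, every n ∈ {1, …, N−1}, and every t on the unit circle 𝕋, the closed ε-pseudospectrum of A is contained in the π-method inclusion set: Spec_ε A ⊆ Π^{n,t}_ε(A); in particular Spec A ⊆ Π^{n,t}_0(A). -/

import Mathlib

open scoped Real

noncomputable section

namespace SpecIncl

/-- The smallest singular value of a (possibly rectangular) complex matrix,
as the infimum of `‖F x‖` over the unit sphere. -/
noncomputable def sval {ι κ : Type*} [Fintype ι] [Fintype κ] [DecidableEq κ]
    (F : Matrix ι κ ℂ) : ℝ :=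
  sInf {y : ℝ | ∃ x : EuclideanSpace ℂ κ, ‖x‖ = 1 ∧ y = ‖Matrix.toEuclideanLin F x‖}

/-- The spectral norm (2-norm) of a complex matrix. -/
noncomputable def opNorm {ι κ : Type*} [Fintype ι] [Fintype κ] [DecidableEq κ]
    (F : Matrix ι κ ℂ) : ℝ :=
  sSup {y : ℝ | ∃ x : EuclideanSpace ℂ κ, ‖x‖ = 1 ∧ y = ‖Matrix.toEuclideanLin F x‖}

/-- The closed ε-pseudospectrum of a square complex matrix. -/
noncomputable def pspec {ι : Type*} [Fintype ι] [DecidableEq ι] (ε : ℝ)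
    (E : Matrix ι ι ℂ) : Set ℂ :=
  {z : ℂ | sval (E - z • (1 : Matrix ι ι ℂ)) ≤ ε}

/-- Assemble blocks into a block matrix indexed by a sigma type. -/
def blockMat {N : ℕ} (m : Fin N → ℕ)
    (a : ∀ i j : Fin N, Matrix (Fin (m i)) (Fin (m j)) ℂ) :
    Matrix ((i : Fin N) × Fin (m i)) ((j : Fin N) × Fin (m j)) ℂ :=
  fun p q => a p.1 q.1 p.2 q.2

/-- The block-tridiagonal part of a block matrix. -/
def triPart {N : ℕ} {m : Fin N → ℕ}
    (a : ∀ i j : Fin N, Matrix (Fin (m i)) (Fin (m j)) ℂ) :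
    ∀ i j : Fin N, Matrix (Fin (m i)) (Fin (m j)) ℂ :=
  fun i j => if |(i : ℤ) - (j : ℤ)| ≤ 1 then a i j else 0

/-- The remaining (off-tridiagonal) part of a block matrix. -/
def remPart {N : ℕ} {m : Fin N → ℕ}
    (a : ∀ i j : Fin N, Matrix (Fin (m i)) (Fin (m j)) ℂ) :
    ∀ i j : Fin N, Matrix (Fin (m i)) (Fin (m j)) ℂ :=
  fun i j => if |(i : ℤ) - (j : ℤ)| ≤ 1 then 0 else a i j

/-- r_L(A): max of the norms of the first-subdiagonal blocks. -/
noncomputable def rL {N : ℕ} {m : Fin N → ℕ}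
    (a : ∀ i j : Fin N, Matrix (Fin (m i)) (Fin (m j)) ℂ) : ℝ :=
  sSup {y : ℝ | ∃ i j : Fin N, (j : ℕ) + 1 = (i : ℕ) ∧ y = opNorm (a i j)}

/-- r_U(A): max of the norms of the first-superdiagonal blocks. -/
noncomputable def rU {N : ℕ} {m : Fin N → ℕ}
    (a : ∀ i j : Fin N, Matrix (Fin (m i)) (Fin (m j)) ℂ) : ℝ :=
  sSup {y : ℝ | ∃ i j : Fin N, (i : ℕ) + 1 = (j : ℕ) ∧ y = opNorm (a i j)}

noncomputable def rA {N : ℕ} {m : Fin N → ℕ}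
    (a : ∀ i j : Fin N, Matrix (Fin (m i)) (Fin (m j)) ℂ) : ℝ :=
  rL a + rU a

/-- θ_n for the coefficient `c = r_L r_U / r²`: the unique solution of
`2 sin(t/2) cos((n+1/2)t) + c sin((n−1)t) = 0` in `[π/(2n+1), π/(n+2)]`
(by uniqueness, equal to the infimum of the solution set). -/
noncomputable def theta (c : ℝ) (n : ℕ) : ℝ :=
  sInf {t : ℝ | t ∈ Set.Icc (Real.pi / (2 * (n : ℝ) + 1)) (Real.pi / ((n : ℝ) + 2)) ∧
    2 * Real.sin (t / 2) * Real.cos (((n : ℝ) + 1 / 2) * t)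
      + c * Real.sin (((n : ℝ) - 1) * t) = 0}

/-- ε_n(A) := 2 r(A) sin(θ_n(A)/2) + ‖C‖. -/
noncomputable def epsTau {N : ℕ} {m : Fin N → ℕ}
    (a : ∀ i j : Fin N, Matrix (Fin (m i)) (Fin (m j)) ℂ) (n : ℕ) : ℝ :=
  2 * rA a * Real.sin (theta (rL a * rU a / (rA a) ^ 2) n / 2)
    + opNorm (blockMat m (remPart a))

/-- The index `k + i` in `Fin N` (0-based window of length `n` starting at `k`). -/
def widx {N n k : ℕ} (h : k + n ≤ N) (i : Fin n) : Fin N :=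
  ⟨k + i, by have := i.isLt; omega⟩

/-- The principal submatrix `B_{n,k}` of a block matrix, with block rows and
columns `k+1,…,k+n` (1-based), i.e. `k,…,k+n-1` (0-based). -/
def window {N : ℕ} {m : Fin N → ℕ}
    (b : ∀ i j : Fin N, Matrix (Fin (m i)) (Fin (m j)) ℂ)
    (n k : ℕ) (h : k + n ≤ N) :
    Matrix ((i : Fin n) × Fin (m (widx h i))) ((j : Fin n) × Fin (m (widx h j))) ℂ :=
  fun p q => b (widx h p.1) (widx h q.1) p.2 q.2

/-- σ^n_ε(A) of the τ-method. -/
noncomputable def sigmaLow {N : ℕ} {m : Fin N → ℕ}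
    (a : ∀ i j : Fin N, Matrix (Fin (m i)) (Fin (m j)) ℂ)
    (n : ℕ) (h : n ≤ N) (ε : ℝ) : Set ℂ :=
  (⋃ k : Fin (N - n + 1),
      pspec (ε + epsTau a n)
        (window (triPart a) n k (by have := k.isLt; omega))) ∪
  (⋃ m' : Fin (n - 1),
      pspec (ε + epsTau a n)
        (window (triPart a) (m' + 1) 0 (by have := m'.isLt; omega)) ∪
      pspec (ε + epsTau a n)
        (window (triPart a) (m' + 1) (N - (m' + 1)) (by have := m'.isLt; omega)))

/-- σ̂^n_ε(A) of the τ-method. -/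
noncomputable def sigmaHat {N : ℕ} {m : Fin N → ℕ}
    (a : ∀ i j : Fin N, Matrix (Fin (m i)) (Fin (m j)) ℂ)
    (n : ℕ) (h : n ≤ N) (ε : ℝ) : Set ℂ :=
  ⋃ k : Fin (N - n + 1),
    pspec (ε + epsTau a (n - 2))
      (window (triPart a) n k (by have := k.isLt; omega))

/-- The τ-method inclusion set Σ^n_ε(A). -/
noncomputable def SigmaTau {N : ℕ} {m : Fin N → ℕ}
    (a : ∀ i j : Fin N, Matrix (Fin (m i)) (Fin (m j)) ℂ)
    (n : ℕ) (h : n ≤ N) (ε : ℝ) : Set ℂ :=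
  if n ≤ 2 then sigmaLow a n h ε else sigmaLow a n h ε ∩ sigmaHat a n h ε


section ConstBlock

variable {N p : ℕ}

/-- The tridiagonal part of a block matrix with constant block size `p`,
extended by zero blocks outside the index range (0-based indices). -/
noncomputable def bTriExt (a : Fin N → Fin N → Matrix (Fin p) (Fin p) ℂ)
    (i j : ℤ) : Matrix (Fin p) (Fin p) ℂ :=
  if h : 0 ≤ i ∧ i < N ∧ 0 ≤ j ∧ j < N ∧ |i - j| ≤ 1 then
    a ⟨i.toNat, by omega⟩ ⟨j.toNat, by omega⟩ else 0

/-- The periodised truncation `B^{per,t}_{n,k}` (0-based `k`; paper's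
`B_{n,k}` has 1-based block rows/columns `k+1,…,k+n`). -/
noncomputable def Bper (a : Fin N → Fin N → Matrix (Fin p) (Fin p) ℂ)
    (n : ℕ) (k : ℤ) (t : ℂ) :
    Matrix ((_ : Fin n) × Fin p) ((_ : Fin n) × Fin p) ℂ :=
  fun q r =>
    (bTriExt a (k + q.1) (k + r.1)
      + (if (q.1 : ℕ) = 0 ∧ (r.1 : ℕ) = n - 1 then t • bTriExt a (k + n) (k + n - 1) else 0)
      + (if (q.1 : ℕ) = n - 1 ∧ (r.1 : ℕ) = 0 then (starRingEnd ℂ) t • bTriExt a (k - 1) k else 0))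
      q.2 r.2

/-- ε'_n(A) := 2 r(A) sin(π/(2n)) + ‖C‖, for a block matrix with constant
block size `p`. -/
noncomputable def epsPer (a : Fin N → Fin N → Matrix (Fin p) (Fin p) ℂ)
    (n : ℕ) : ℝ :=
  2 * rA (m := fun _ : Fin N => p) a * Real.sin (Real.pi / (2 * (n : ℝ)))
    + opNorm (blockMat (fun _ : Fin N => p) (remPart (m := fun _ : Fin N => p) a))

/-- The π-method inclusion set Π^{n,t}_ε(A). -/
noncomputable def PiMethod (a : Fin N → Fin N → Matrix (Fin p) (Fin p) ℂ)
    (n : ℕ) (t : ℂ) (ε : ℝ) : Set ℂ :=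
  ⋃ k : Fin (N - n + 1), pspec (ε + epsPer a n) (Bper a n (k : ℕ) t)

end ConstBlock

end SpecIncl

namespace SpecIncl

section FiniteSums

variable {M : Type*} [AddCommMonoid M]

/-- Two finite sums of a function agree when both index sets contain its support. -/
lemma sum_eq_sum_of_support {ι : Type*} {A B : Finset ι} {h : ι → M}
    (hA : ∀ j, j ∉ A → h j = 0) (hB : ∀ j, j ∉ B → h j = 0) :
    ∑ j ∈ A, h j = ∑ j ∈ B, h j := by
  rw [← finsum_eq_sum_of_support_subset h (s := A), ← finsum_eq_sum_of_support_subset h (s := B)]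
  · intro j hj
    by_contra hc
    exact hj (hB j (by simpa using hc))
  · intro j hj
    by_contra hc
    exact hj (hA j (by simpa using hc))

lemma sum_range_add_eq_sum_Ico (h : ℤ → M) (c : ℤ) (m : ℕ) :
    ∑ q ∈ Finset.range m, h (c + q) = ∑ j ∈ Finset.Ico c (c + m), h j := by
  refine Finset.sum_bij' (fun q _ => c + (q : ℤ)) (fun j _ => (j - c).toNat) ?_ ?_ ?_ ?_ ?_
  · intro q hq
    simp only [Finset.mem_range, Finset.mem_Ico] at *
    omega
  · intro j hj
    simp only [Finset.mem_range, Finset.mem_Ico] at *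
    omega
  · intro q _
    omega
  · intro j hj
    simp only [Finset.mem_Ico] at hj
    omega
  · intro q _
    rfl

/-- A sum over a window of a function supported at distance at most one from `i`. -/
lemma sum_window_eq_three (h : ℤ → M) (i k : ℤ) (m : ℕ)
    (hfar : ∀ j, 1 < |i - j| → h j = 0) (hout : ∀ j, ¬(k ≤ j ∧ j < k + m) → h j = 0) :
    ∑ r ∈ Finset.range m, h (k + r) = h (i - 1) + h i + h (i + 1) := by
  rw [sum_range_add_eq_sum_Ico,
    sum_eq_sum_of_support (B := ({i - 1, i, i + 1} : Finset ℤ))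
      (fun j hj => hout j (by simpa using hj)),
    Finset.sum_insert (by simp; omega), Finset.sum_insert (by simp), Finset.sum_singleton,
    add_assoc]
  intro j hj
  apply hfar
  simp only [Finset.mem_insert, Finset.mem_singleton] at hj
  rw [lt_abs]
  omega

lemma sum_window_le (g : ℤ → ℝ) (hg : ∀ j, 0 ≤ g j) (N : ℕ)
    (hout : ∀ j, ¬(0 ≤ j ∧ j < (N : ℤ)) → g j = 0) (c : ℤ) (m : ℕ) :
    ∑ q ∈ Finset.range m, g (c + q) ≤ ∑ j ∈ Finset.Ico (0 : ℤ) N, g j := by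
  rw [sum_range_add_eq_sum_Ico]
  calc ∑ j ∈ Finset.Ico c (c + m), g j
      ≤ ∑ j ∈ Finset.Ico c (c + m) ∪ Finset.Ico (0 : ℤ) N, g j :=
        Finset.sum_le_sum_of_subset_of_nonneg Finset.subset_union_left fun j _ _ => hg j
    _ = ∑ j ∈ Finset.Ico (0 : ℤ) N, g j := by
        refine (Finset.sum_subset Finset.subset_union_right fun j _ hj => hout j ?_).symm
        simpa using hj

lemma sum_translates (f : ℤ → ℝ) (n N : ℕ) (hf : ∀ j, ¬(-1 ≤ j ∧ j ≤ (n : ℤ)) → f j = 0)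
    {j : ℤ} (hj : 0 ≤ j ∧ j < (N : ℤ)) :
    ∑ s ∈ Finset.Icc (-(n : ℤ)) N, f (j - s) = ∑ i ∈ Finset.Icc (-1 : ℤ) n, f i := by
  have h : ∑ s ∈ Finset.Icc (-(n : ℤ)) N, f (j - s)
      = ∑ s ∈ Finset.Icc (j - n) (j + 1), f (j - s) := by
    apply sum_eq_sum_of_support <;>
    · intro s hs
      apply hf
      simp only [Finset.mem_Icc] at hs
      omega
  rw [h]
  refine Finset.sum_bij' (fun s _ => j - s) (fun i _ => j - i) ?_ ?_ ?_ ?_ ?_ <;> intro i hi <;>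
    simp only [Finset.mem_Icc] at * <;> omega

/-- Summing all translates of a weight against a sequence on `{0, …, N - 1}`. -/
lemma sum_translates_mul (f g : ℤ → ℝ) (n N : ℕ)
    (hf : ∀ j, ¬(-1 ≤ j ∧ j ≤ (n : ℤ)) → f j = 0) :
    ∑ s ∈ Finset.Icc (-(n : ℤ)) N, ∑ j ∈ Finset.Ico (0 : ℤ) N, f (j - s) * g j
      = (∑ i ∈ Finset.Icc (-1 : ℤ) n, f i) * ∑ j ∈ Finset.Ico (0 : ℤ) N, g j := by
  rw [Finset.sum_comm, Finset.mul_sum]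
  refine Finset.sum_congr rfl fun j hj => ?_
  rw [← Finset.sum_mul, sum_translates f n N hf (by simpa using hj)]

/-- Minkowski's inequality in squared form. -/
lemma sum_norm_add_sq_le {ι E : Type*} [NormedAddCommGroup E] (I : Finset ι) (f g : ι → E)
    {α γ : ℝ} (hα : 0 ≤ α) (hγ : 0 ≤ γ) (hf : ∑ i ∈ I, ‖f i‖ ^ 2 ≤ α ^ 2)
    (hg : ∑ i ∈ I, ‖g i‖ ^ 2 ≤ γ ^ 2) :
    ∑ i ∈ I, ‖f i + g i‖ ^ 2 ≤ (α + γ) ^ 2 := by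
  have hcs : ∑ i ∈ I, ‖f i‖ * ‖g i‖ ≤ α * γ := by
    refine abs_le_of_sq_le_sq' ?_ (mul_nonneg hα hγ) |>.2
    calc (∑ i ∈ I, ‖f i‖ * ‖g i‖) ^ 2
        ≤ (∑ i ∈ I, ‖f i‖ ^ 2) * ∑ i ∈ I, ‖g i‖ ^ 2 := Finset.sum_mul_sq_le_sq_mul_sq _ _ _
      _ ≤ α ^ 2 * γ ^ 2 := by gcongr
      _ = (α * γ) ^ 2 := by ring
  calc ∑ i ∈ I, ‖f i + g i‖ ^ 2
      ≤ ∑ i ∈ I, (‖f i‖ ^ 2 + 2 * (‖f i‖ * ‖g i‖) + ‖g i‖ ^ 2) := by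
        refine Finset.sum_le_sum fun i _ => ?_
        have := norm_add_le (f i) (g i)
        nlinarith [norm_nonneg (f i + g i), norm_nonneg (f i), norm_nonneg (g i)]
    _ = ∑ i ∈ I, ‖f i‖ ^ 2 + 2 * ∑ i ∈ I, ‖f i‖ * ‖g i‖ + ∑ i ∈ I, ‖g i‖ ^ 2 := by
        rw [Finset.sum_add_distrib, Finset.sum_add_distrib, Finset.mul_sum]
    _ ≤ (α + γ) ^ 2 := by nlinarith

end FiniteSums

section Weights

/-- The sine weights on a window of length `n`, extended by zero. -/
def wt (n : ℕ) (j : ℤ) : ℝ :=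
  if 0 ≤ j ∧ j < (n : ℤ) then Real.sin (π * (j + 1 / 2) / n) else 0

/-- Squared increments of the weights, doubled at the two ends of the window. -/
def dwt (n : ℕ) (j : ℤ) : ℝ :=
  (if j = -1 ∨ j = (n : ℤ) - 1 then 2 else 1) * (wt n (j + 1) - wt n j) ^ 2

lemma wt_eq_zero {n : ℕ} {j : ℤ} (h : ¬(0 ≤ j ∧ j < (n : ℤ))) : wt n j = 0 := if_neg h

lemma dwt_nonneg (n : ℕ) (j : ℤ) : 0 ≤ dwt n j := by
  unfold dwt
  split_ifs <;> positivity

lemma sq_sub_le_dwt (n : ℕ) (j : ℤ) : (wt n (j + 1) - wt n j) ^ 2 ≤ dwt n j := by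
  unfold dwt
  split_ifs <;> nlinarith [sq_nonneg (wt n (j + 1) - wt n j)]

lemma dwt_eq_zero {n : ℕ} {j : ℤ} (h : ¬(-1 ≤ j ∧ j ≤ (n : ℤ) - 1)) : dwt n j = 0 := by
  unfold dwt
  rw [wt_eq_zero (by omega), wt_eq_zero (by omega)]
  simp

lemma sin_pi_div_two_mul_nonneg {n : ℕ} (hn : 1 ≤ n) : 0 ≤ Real.sin (π / (2 * n)) := by
  have hn' : (1 : ℝ) ≤ n := by exact_mod_cast hn
  refine Real.sin_nonneg_of_nonneg_of_le_pi (by positivity) ?_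
  rw [div_le_iff₀ (by positivity)]
  nlinarith [Real.pi_pos]

lemma sum_cos_eq_zero {n : ℕ} (hn : 1 ≤ n) :
    ∑ m ∈ Finset.range (2 * n), Real.cos (π * m / n) = 0 := by
  have hn' : (n : ℝ) ≠ 0 := by positivity
  rw [two_mul, Finset.sum_range_add, ← Finset.sum_add_distrib]
  refine Finset.sum_eq_zero fun m _ => ?_
  have : π * ((n + m : ℕ) : ℝ) / n = π * m / n + π := by
    push_cast
    field_simp
    ring
  rw [this, Real.cos_add_pi, add_neg_cancel]

lemma sum_cos_sq_eq_sum_sin_sq {n : ℕ} (hn : 1 ≤ n) :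
    ∑ j ∈ Finset.range n, Real.cos (π * j / n) ^ 2
      = ∑ j ∈ Finset.range n, Real.sin (π * (j + 1 / 2) / n) ^ 2 := by
  have hn' : (n : ℝ) ≠ 0 := by positivity
  have hpair : ∀ (f : ℕ → ℝ) (m : ℕ),
      ∑ i ∈ Finset.range (2 * m), f i = ∑ j ∈ Finset.range m, (f (2 * j) + f (2 * j + 1)) := by
    intro f m
    induction m with
    | zero => simp
    | succ m ih =>
      rw [mul_add, mul_one, Finset.sum_range_succ, Finset.sum_range_succ, ih,
        Finset.sum_range_succ, add_assoc]
  have h := sum_cos_eq_zero hn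
  rw [hpair] at h
  rw [← sub_eq_zero, ← Finset.sum_sub_distrib]
  calc _ = ∑ j ∈ Finset.range n,
        (Real.cos (π * ((2 * j : ℕ) : ℝ) / n) + Real.cos (π * ((2 * j + 1 : ℕ) : ℝ) / n)) / 2 := by
        refine Finset.sum_congr rfl fun j _ => ?_
        have e₁ : π * ((2 * j : ℕ) : ℝ) / n = 2 * (π * j / n) := by
          push_cast
          ring
        have e₂ : π * ((2 * j + 1 : ℕ) : ℝ) / n = 2 * (π * (j + 1 / 2) / n) := by
          push_cast
          ring
        rw [e₁, e₂, Real.cos_two_mul, Real.cos_two_mul, Real.sin_sq]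
        ring
    _ = 0 := by rw [← Finset.sum_div, h, zero_div]

lemma sum_wt_sq (n : ℕ) : ∑ j ∈ Finset.Icc (-1 : ℤ) n, wt n j ^ 2
    = ∑ j ∈ Finset.range n, Real.sin (π * (j + 1 / 2) / n) ^ 2 := by
  have h : ∑ j ∈ Finset.Icc (-1 : ℤ) n, wt n j ^ 2
      = ∑ j ∈ Finset.Ico (0 : ℤ) (0 + n), wt n j ^ 2 := by
    apply sum_eq_sum_of_support <;>
    · intro j hj
      simp only [Finset.mem_Icc, Finset.mem_Ico] at hj
      rw [wt_eq_zero (by omega)]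
      simp
  rw [h, ← sum_range_add_eq_sum_Ico (fun j => wt n j ^ 2)]
  refine Finset.sum_congr rfl fun j hj => ?_
  have := Finset.mem_range.1 hj
  rw [wt, if_pos (by omega)]
  push_cast
  rw [zero_add]

lemma sum_wt_sq_pos {n : ℕ} (hn : 1 ≤ n) : 0 < ∑ j ∈ Finset.Icc (-1 : ℤ) n, wt n j ^ 2 := by
  have hn' : (0 : ℝ) < n := by positivity
  rw [sum_wt_sq]
  refine Finset.sum_pos (fun j hj => pow_pos (Real.sin_pos_of_pos_of_lt_pi ?_ ?_) 2)
    (Finset.nonempty_range_iff.2 (by omega))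
  · positivity
  · rw [div_lt_iff₀ hn']
    have : (j : ℝ) + 1 ≤ n := by exact_mod_cast Finset.mem_range.1 hj
    gcongr
    linarith

lemma sum_dwt {n : ℕ} (hn : 1 ≤ n) : ∑ j ∈ Finset.Icc (-1 : ℤ) n, dwt n j
    = (2 * Real.sin (π / (2 * n))) ^ 2 * ∑ j ∈ Finset.Icc (-1 : ℤ) n, wt n j ^ 2 := by
  have hn' : (n : ℝ) ≠ 0 := by positivity
  set ψ : ℝ → ℝ := fun j => Real.sin (π * (j + 1 / 2) / n) with hψ
  have hdiff : ∀ j : ℝ, ψ j - ψ (j - 1) = 2 * Real.sin (π / (2 * n)) * Real.cos (π * j / n) := by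
    intro j
    simp only [hψ]
    rw [Real.sin_sub_sin]
    congr 2
    · congr 1
      field_simp
      ring
    · field_simp
      ring
  have hrhs : (2 * Real.sin (π / (2 * n))) ^ 2 * ∑ j ∈ Finset.Icc (-1 : ℤ) n, wt n j ^ 2
      = ∑ j ∈ Finset.range n, (ψ j - ψ (j - 1)) ^ 2 := by
    rw [sum_wt_sq, ← sum_cos_sq_eq_sum_sin_sq hn, Finset.mul_sum]
    refine Finset.sum_congr rfl fun j _ => ?_
    rw [hdiff, mul_pow _ (Real.cos _)]
  have hlhs : ∑ j ∈ Finset.Icc (-1 : ℤ) n, dwt n j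
      = ∑ j ∈ Finset.range (n + 1), dwt n (-1 + j) := by
    rw [sum_range_add_eq_sum_Ico]
    apply sum_eq_sum_of_support <;>
    · intro j hj
      simp only [Finset.mem_Icc, Finset.mem_Ico] at hj
      exact dwt_eq_zero (by push_cast at hj; omega)
  have hwt : ∀ j : ℕ, j < n → wt n (j : ℤ) = ψ j := by
    intro j hj
    rw [wt, if_pos (by omega)]
    simp [hψ]
  have hψneg : ψ (0 - 1) = -ψ 0 := by
    simp only [hψ]
    rw [← Real.sin_neg]
    congr 1
    ring
  have hψlast : ψ ((n - 1 : ℕ) : ℝ) = ψ 0 := by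
    simp only [hψ]
    rw [← Real.sin_pi_sub]
    congr 1
    push_cast [Nat.cast_sub hn]
    field_simp
    ring
  rw [hlhs, hrhs]
  obtain ⟨m, rfl⟩ : ∃ m, n = m + 1 := ⟨n - 1, by omega⟩
  rw [Finset.sum_range_succ', Finset.sum_range_succ, Finset.sum_range_succ']
  have hmid : ∀ j ∈ Finset.range m, dwt (m + 1) (-1 + ((j + 1 : ℕ) : ℤ))
      = (ψ ((j + 1 : ℕ) : ℝ) - ψ (((j + 1 : ℕ) : ℝ) - 1)) ^ 2 := by
    intro j hj
    have hj' := Finset.mem_range.1 hj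
    have e : -1 + ((j + 1 : ℕ) : ℤ) = (j : ℤ) := by
      push_cast
      ring
    have hc : ¬((j : ℤ) = -1 ∨ (j : ℤ) = ((m + 1 : ℕ) : ℤ) - 1) := by omega
    rw [e, dwt, if_neg hc, one_mul, hwt j (by omega)]
    have e' := hwt (j + 1) (by omega)
    push_cast at e' ⊢
    rw [e', add_sub_cancel_right]
  rw [Finset.sum_congr rfl hmid, add_assoc]
  congr 1
  have h₁ : dwt (m + 1) (-1 + ((m + 1 : ℕ) : ℤ)) = 2 * ψ 0 ^ 2 := by
    have e : -1 + ((m + 1 : ℕ) : ℤ) = (m : ℤ) := by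
      push_cast
      ring
    rw [e, dwt, if_pos (by push_cast; omega), wt_eq_zero (by push_cast; omega),
      hwt m (by omega)]
    rw [show m + 1 - 1 = m by omega] at hψlast
    rw [hψlast]
    ring
  have h₂ : dwt (m + 1) (-1 + ((0 : ℕ) : ℤ)) = 2 * ψ 0 ^ 2 := by
    have e := hwt 0 (by omega)
    push_cast at e
    rw [dwt, if_pos (by simp), wt_eq_zero (j := -1 + ((0 : ℕ) : ℤ)) (by simp)]
    simp only [Nat.cast_zero, add_zero, neg_add_cancel, e]
    ring
  rw [h₁, h₂]
  push_cast
  rw [hψneg]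
  ring

end Weights

section Windows

lemma sq_norm_add_le {E : Type*} [SeminormedAddCommGroup E] (u v : E) : ‖u + v‖ ^ 2 ≤ 2 * ‖u‖ ^ 2 + 2 * ‖v‖ ^ 2 := by
  have := norm_add_le u v
  nlinarith [norm_nonneg (u + v), sq_nonneg (‖u‖ - ‖v‖)]

variable {E : Type*} [NormedAddCommGroup E] [NormedSpace ℂ E]

/-- Row `q` of `(B^{per,t}_{n,k} - z) v` for the band operator with blocks `β`, with `v` indexed
by `ℤ`. -/
def perRow (β : ℤ → ℤ → E →ₗ[ℂ] E) (n : ℕ) (k : ℤ) (t z : ℂ) (v : ℤ → E) (q : ℕ) : E :=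
  ∑ r ∈ Finset.range n, β (k + q) (k + r) (v (k + r))
    + (if q = 0 then t • β (k + n) (k + n - 1) (v (k + n - 1)) else 0)
    + (if q = n - 1 then (starRingEnd ℂ) t • β (k - 1) k (v k) else 0)
    - z • v (k + q)

/-- Row `i` of `(B - z) x` for the band operator with blocks `β`. -/
def triRow (β : ℤ → ℤ → E →ₗ[ℂ] E) (z : ℂ) (x : ℤ → E) (i : ℤ) : E :=
  β i (i - 1) (x (i - 1)) + β i i (x i) + β i (i + 1) (x (i + 1)) - z • x i

/-- The position of the window that carries the weights starting at `s`. -/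
def clampPos (N n : ℕ) (s : ℤ) : ℤ := max 0 (min s ((N : ℤ) - n))

/-- The part of the commutator of `B^{per,t}_{n,k}` with the weights coming from the
subdiagonal blocks. -/
def lowerErr (β : ℤ → ℤ → E →ₗ[ℂ] E) (n : ℕ) (k s : ℤ) (t : ℂ) (x : ℤ → E) (q : ℕ) : E :=
  ((wt n (k + q - 1 - s) - wt n (k + q - s) : ℝ) : ℂ) • β (k + q) (k + q - 1) (x (k + q - 1))
    + (if q = 0 then
        (t * (wt n (k + n - 1 - s) : ℝ)) • β (k + n) (k + n - 1) (x (k + n - 1)) else 0)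

/-- The part of the commutator of `B^{per,t}_{n,k}` with the weights coming from the
superdiagonal blocks. -/
def upperErr (β : ℤ → ℤ → E →ₗ[ℂ] E) (n : ℕ) (k s : ℤ) (t : ℂ) (x : ℤ → E) (q : ℕ) : E :=
  ((wt n (k + q + 1 - s) - wt n (k + q - s) : ℝ) : ℂ) • β (k + q) (k + q + 1) (x (k + q + 1))
    + (if q = n - 1 then
        ((starRingEnd ℂ) t * (wt n (k - s) : ℝ)) • β (k - 1) k (x k) else 0)

/-- A weighted vector whose support is a window of length `n` starting at `s`. -/
def wvec (n : ℕ) (s : ℤ) (x : ℤ → E) (j : ℤ) : E := ((wt n (j - s) : ℝ) : ℂ) • x j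

lemma wvec_eq_zero {N n : ℕ} {s : ℤ} (hnN : n ≤ N) {x : ℤ → E}
    (hx : ∀ j, ¬(0 ≤ j ∧ j < (N : ℤ)) → x j = 0) {j : ℤ}
    (hj : ¬(clampPos N n s ≤ j ∧ j < clampPos N n s + n)) : wvec n s x j = 0 := by
  unfold wvec
  by_cases h : 0 ≤ j ∧ j < (N : ℤ)
  · rw [wt_eq_zero]
    · simp
    · unfold clampPos at hj
      omega
  · rw [hx j h, smul_zero]

lemma perRow_wvec {β : ℤ → ℤ → E →ₗ[ℂ] E} {N n : ℕ} {s : ℤ} (hnN : n ≤ N)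
    (hβ : ∀ i j, 1 < |i - j| → β i j = 0) {x : ℤ → E}
    (hx : ∀ j, ¬(0 ≤ j ∧ j < (N : ℤ)) → x j = 0) (t z : ℂ) (q : ℕ) :
    perRow β n (clampPos N n s) t z (wvec n s x) q
      = ((wt n (clampPos N n s + q - s) : ℝ) : ℂ) • triRow β z x (clampPos N n s + q)
        + (lowerErr β n (clampPos N n s) s t x q + upperErr β n (clampPos N n s) s t x q) := by
  set k := clampPos N n s with hk
  unfold perRow
  rw [sum_window_eq_three (fun j => β (k + q) j (wvec n s x j)) (k + q) k n
    (fun j hj => by simp [hβ _ _ hj])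
    (fun j hj => by rw [wvec_eq_zero hnN hx hj, map_zero])]
  unfold triRow lowerErr upperErr wvec
  simp only [map_smul]
  split_ifs <;> push_cast <;> module

lemma sq_norm_smul_apply_le {f : E →ₗ[ℂ] E} {r : ℝ} (hf : ∀ v, ‖f v‖ ≤ r * ‖v‖) (c : ℂ) (v : E) :
    ‖c • f v‖ ^ 2 ≤ r ^ 2 * (‖c‖ ^ 2 * ‖v‖ ^ 2) := by
  rw [norm_smul]
  calc (‖c‖ * ‖f v‖) ^ 2 ≤ (‖c‖ * (r * ‖v‖)) ^ 2 := by
        gcongr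
        exact hf v
    _ = _ := by ring

lemma sum_sq_norm_lowerErr_le {β : ℤ → ℤ → E →ₗ[ℂ] E} {N n : ℕ} (hn : 1 ≤ n)
    (hβ : ∀ i j, ¬(0 ≤ i ∧ i < (N : ℤ)) ∨ ¬(0 ≤ j ∧ j < (N : ℤ)) → β i j = 0) {r : ℝ}
    (hr : ∀ i v, ‖β i (i - 1) v‖ ≤ r * ‖v‖) {x : ℤ → E}
    (hx : ∀ j, ¬(0 ≤ j ∧ j < (N : ℤ)) → x j = 0) {t : ℂ} (ht : ‖t‖ = 1) (s : ℤ) :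
    ∑ q ∈ Finset.range n, ‖lowerErr β n (clampPos N n s) s t x q‖ ^ 2
      ≤ r ^ 2 * ∑ j ∈ Finset.Ico (0 : ℤ) N, dwt n (j - s) * ‖x j‖ ^ 2 := by
  set k := clampPos N n s with hk
  set g : ℤ → ℝ := fun j => dwt n (j - s) * ‖x j‖ ^ 2 with hg
  have hg0 : ∀ j, 0 ≤ g j := fun j => mul_nonneg (dwt_nonneg _ _) (sq_nonneg _)
  have hinc : ∀ i : ℤ, ‖((wt n (i - 1 - s) - wt n (i - s) : ℝ) : ℂ) • β i (i - 1) (x (i - 1))‖ ^ 2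
      ≤ r ^ 2 * ((wt n (i - 1 - s + 1) - wt n (i - 1 - s)) ^ 2 * ‖x (i - 1)‖ ^ 2) := by
    intro i
    refine (sq_norm_smul_apply_le (hr i) _ _).trans (le_of_eq ?_)
    rw [Complex.norm_real, Real.norm_eq_abs, sq_abs, show i - 1 - s + 1 = i - s by ring]
    ring
  have hpos : ∀ q ∈ Finset.range n, q ≠ 0 →
      ‖lowerErr β n k s t x q‖ ^ 2 ≤ r ^ 2 * g (k - 1 + q) := by
    intro q _ hq
    rw [lowerErr, if_neg hq, add_zero, show k - 1 + (q : ℤ) = k + q - 1 by ring]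
    refine (hinc _).trans ?_
    simp only [hg]
    gcongr
    exact sq_sub_le_dwt _ _
  have hzero : ‖lowerErr β n k s t x 0‖ ^ 2 ≤ r ^ 2 * (g (k - 1) + g (k + n - 1)) := by
    rw [lowerErr, if_pos rfl]
    simp only [Nat.cast_zero, add_zero]
    by_cases hs : k = s
    · refine (sq_norm_add_le _ _).trans ?_
      have h₁ := hinc k
      have h₂ : ‖(t * (wt n (k + n - 1 - s) : ℝ)) • β (k + n) (k + n - 1) (x (k + n - 1))‖ ^ 2
          ≤ r ^ 2 * (wt n (k + n - 1 - s) ^ 2 * ‖x (k + n - 1)‖ ^ 2) := by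
        refine (sq_norm_smul_apply_le (hr _) _ _).trans (le_of_eq ?_)
        rw [norm_mul, ht, one_mul, Complex.norm_real, Real.norm_eq_abs, sq_abs]
      have e₁ : g (k - 1)
          = 2 * ((wt n (k - 1 - s + 1) - wt n (k - 1 - s)) ^ 2 * ‖x (k - 1)‖ ^ 2) := by
        simp only [hg, dwt]
        rw [if_pos (by omega)]
        ring
      have e₂ : g (k + n - 1) = 2 * (wt n (k + n - 1 - s) ^ 2 * ‖x (k + n - 1)‖ ^ 2) := by
        simp only [hg, dwt]
        rw [if_pos (by omega), wt_eq_zero (j := k + n - 1 - s + 1) (by omega)]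
        ring
      rw [e₁, e₂]
      linarith
    · have : ((wt n (k - 1 - s) - wt n (k - s) : ℝ) : ℂ) • β k (k - 1) (x (k - 1))
          + (t * (wt n (k + n - 1 - s) : ℝ)) • β (k + n) (k + n - 1) (x (k + n - 1)) = 0 := by
        unfold clampPos at hk
        rcases lt_or_ge s 0 with h | h
        · rw [hβ k (k - 1) (by omega), wt_eq_zero (j := k + n - 1 - s) (by omega)]
          simp
        · rw [hβ (k + n) (k + n - 1) (by omega), wt_eq_zero (j := k - 1 - s) (by omega),
            wt_eq_zero (j := k - s) (by omega)]
          simp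
      rw [this, norm_zero]
      rw [zero_pow two_ne_zero]
      exact mul_nonneg (sq_nonneg r) (add_nonneg (hg0 _) (hg0 _))
  calc ∑ q ∈ Finset.range n, ‖lowerErr β n k s t x q‖ ^ 2
      ≤ ∑ q ∈ Finset.range n, r ^ 2 * (g (k - 1 + q) + if q = 0 then g (k + n - 1) else 0) := by
        refine Finset.sum_le_sum fun q hq => ?_
        split_ifs with h
        · subst h
          simpa using hzero
        · simpa using hpos q hq h
    _ = r ^ 2 * ∑ q ∈ Finset.range (n + 1), g (k - 1 + q) := by
        rw [← Finset.mul_sum, Finset.sum_add_distrib, Finset.sum_ite_eq' (Finset.range n) 0,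
          if_pos (by simp; omega), Finset.sum_range_succ, show k - 1 + (n : ℤ) = k + n - 1 by ring]
    _ ≤ _ := by
        gcongr
        refine sum_window_le g hg0 N (fun j hj => ?_) _ _
        simp [hg, hx j hj]

lemma sum_sq_norm_upperErr_le {β : ℤ → ℤ → E →ₗ[ℂ] E} {N n : ℕ} (hn : 1 ≤ n)
    (hβ : ∀ i j, ¬(0 ≤ i ∧ i < (N : ℤ)) ∨ ¬(0 ≤ j ∧ j < (N : ℤ)) → β i j = 0) {r : ℝ}
    (hr : ∀ i v, ‖β i (i + 1) v‖ ≤ r * ‖v‖) {x : ℤ → E}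
    (hx : ∀ j, ¬(0 ≤ j ∧ j < (N : ℤ)) → x j = 0) {t : ℂ} (ht : ‖t‖ = 1) (s : ℤ) :
    ∑ q ∈ Finset.range n, ‖upperErr β n (clampPos N n s) s t x q‖ ^ 2
      ≤ r ^ 2 * ∑ j ∈ Finset.Ico (0 : ℤ) N, dwt n (j - s - 1) * ‖x j‖ ^ 2 := by
  set k := clampPos N n s with hk
  set g : ℤ → ℝ := fun j => dwt n (j - s - 1) * ‖x j‖ ^ 2 with hg
  have hg0 : ∀ j, 0 ≤ g j := fun j => mul_nonneg (dwt_nonneg _ _) (sq_nonneg _)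
  have hinc : ∀ i : ℤ, ‖((wt n (i + 1 - s) - wt n (i - s) : ℝ) : ℂ) • β i (i + 1) (x (i + 1))‖ ^ 2
      ≤ r ^ 2 * ((wt n (i + 1 - s - 1 + 1) - wt n (i + 1 - s - 1)) ^ 2 * ‖x (i + 1)‖ ^ 2) := by
    intro i
    refine (sq_norm_smul_apply_le (hr i) _ _).trans (le_of_eq ?_)
    rw [Complex.norm_real, Real.norm_eq_abs, sq_abs, show i + 1 - s - 1 + 1 = i + 1 - s by ring,
      show i + 1 - s - 1 = i - s by ring]
  have hinit : ∀ q ∈ Finset.range n, q ≠ n - 1 →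
      ‖upperErr β n k s t x q‖ ^ 2 ≤ r ^ 2 * g (k + (q + 1 : ℕ)) := by
    intro q _ hq
    rw [upperErr, if_neg hq, add_zero, show k + ((q + 1 : ℕ) : ℤ) = k + q + 1 by push_cast; ring]
    refine (hinc _).trans ?_
    simp only [hg]
    gcongr
    exact sq_sub_le_dwt _ _
  have hlast : ‖upperErr β n k s t x (n - 1)‖ ^ 2
      ≤ r ^ 2 * (g (k + (n - 1 + 1 : ℕ)) + g k) := by
    rw [upperErr, if_pos rfl, show k + ((n - 1 + 1 : ℕ) : ℤ) = k + (n - 1 : ℕ) + 1 by omega]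
    by_cases hs : k = s
    · refine (sq_norm_add_le _ _).trans ?_
      have h₁ := hinc (k + (n - 1 : ℕ))
      have h₂ : ‖((starRingEnd ℂ) t * (wt n (k - s) : ℝ)) • β (k - 1) k (x k)‖ ^ 2
          ≤ r ^ 2 * (wt n (k - s) ^ 2 * ‖x k‖ ^ 2) := by
        have hr' := hr (k - 1)
        rw [sub_add_cancel] at hr'
        refine (sq_norm_smul_apply_le hr' _ _).trans (le_of_eq ?_)
        rw [norm_mul, RCLike.norm_conj, ht, one_mul, Complex.norm_real, Real.norm_eq_abs, sq_abs]
      have e₁ : g (k + (n - 1 : ℕ) + 1)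
          = 2 * ((wt n (k + (n - 1 : ℕ) + 1 - s - 1 + 1) - wt n (k + (n - 1 : ℕ) + 1 - s - 1)) ^ 2
            * ‖x (k + (n - 1 : ℕ) + 1)‖ ^ 2) := by
        simp only [hg, dwt]
        rw [if_pos (by omega)]
        ring
      have e₂ : g k = 2 * (wt n (k - s) ^ 2 * ‖x k‖ ^ 2) := by
        simp only [hg, dwt]
        rw [if_pos (by omega), wt_eq_zero (j := k - s - 1) (by omega), sub_add_cancel]
        ring
      rw [e₁, e₂]
      linarith
    · have : ((wt n (k + (n - 1 : ℕ) + 1 - s) - wt n (k + (n - 1 : ℕ) - s) : ℝ) : ℂ)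
            • β (k + (n - 1 : ℕ)) (k + (n - 1 : ℕ) + 1) (x (k + (n - 1 : ℕ) + 1))
          + ((starRingEnd ℂ) t * (wt n (k - s) : ℝ)) • β (k - 1) k (x k) = 0 := by
        unfold clampPos at hk
        rcases lt_or_ge s 0 with h | h
        · rw [hβ (k - 1) k (by omega), wt_eq_zero (j := k + (n - 1 : ℕ) + 1 - s) (by omega),
            wt_eq_zero (j := k + (n - 1 : ℕ) - s) (by omega)]
          simp
        · rw [hβ (k + (n - 1 : ℕ)) _ (by omega), wt_eq_zero (j := k - s) (by omega)]
          simp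
      rw [this, norm_zero]
      rw [zero_pow two_ne_zero]
      exact mul_nonneg (sq_nonneg r) (add_nonneg (hg0 _) (hg0 _))
  calc ∑ q ∈ Finset.range n, ‖upperErr β n k s t x q‖ ^ 2
      ≤ ∑ q ∈ Finset.range n, r ^ 2 * (g (k + (q + 1 : ℕ)) + if q = n - 1 then g k else 0) := by
        refine Finset.sum_le_sum fun q hq => ?_
        split_ifs with h
        · rw [h]
          exact hlast
        · rw [add_zero]
          exact hinit q hq h
    _ = r ^ 2 * ∑ q ∈ Finset.range (n + 1), g (k + q) := by
        rw [← Finset.mul_sum, Finset.sum_add_distrib, Finset.sum_ite_eq' (Finset.range n) (n - 1),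
          if_pos (by simp; omega), Finset.sum_range_succ']
        simp
    _ ≤ _ := by
        gcongr
        refine sum_window_le g hg0 N (fun j hj => ?_) _ _
        simp [hg, hx j hj]

/-- The total squared size of the windowed residuals is controlled by the global residual. -/
lemma sum_sq_norm_perRow_le {β : ℤ → ℤ → E →ₗ[ℂ] E} {N n : ℕ} (hn : 1 ≤ n) (hnN : n ≤ N)
    (hband : ∀ i j, 1 < |i - j| → β i j = 0)
    (hβ : ∀ i j, ¬(0 ≤ i ∧ i < (N : ℤ)) ∨ ¬(0 ≤ j ∧ j < (N : ℤ)) → β i j = 0)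
    {rl ru : ℝ} (hrl0 : 0 ≤ rl) (hru0 : 0 ≤ ru)
    (hrl : ∀ i v, ‖β i (i - 1) v‖ ≤ rl * ‖v‖) (hru : ∀ i v, ‖β i (i + 1) v‖ ≤ ru * ‖v‖)
    {x : ℤ → E} (hx : ∀ j, ¬(0 ≤ j ∧ j < (N : ℤ)) → x j = 0) {t : ℂ} (ht : ‖t‖ = 1) (z : ℂ)
    (hx1 : ∑ j ∈ Finset.Ico (0 : ℤ) N, ‖x j‖ ^ 2 = 1) {δ : ℝ} (hδ : 0 ≤ δ)
    (hres : ∑ j ∈ Finset.Ico (0 : ℤ) N, ‖triRow β z x j‖ ^ 2 ≤ δ ^ 2) :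
    ∑ s ∈ Finset.Icc (-(n : ℤ)) N, ∑ q ∈ Finset.range n,
        ‖perRow β n (clampPos N n s) t z (wvec n s x) q‖ ^ 2
      ≤ (δ + 2 * (rl + ru) * Real.sin (π / (2 * n))) ^ 2
        * ∑ j ∈ Finset.Icc (-1 : ℤ) n, wt n j ^ 2 := by
  set S := ∑ j ∈ Finset.Icc (-1 : ℤ) n, wt n j ^ 2 with hS
  have hS0 : 0 ≤ S := (sum_wt_sq_pos hn).le
  set σ := Real.sin (π / (2 * n)) with hσ
  have hσ0 : 0 ≤ σ := sin_pi_div_two_mul_nonneg hn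
  have htri : ∀ j, ¬(0 ≤ j ∧ j < (N : ℤ)) → triRow β z x j = 0 := by
    intro j hj
    rw [triRow, hβ j _ (Or.inl hj), hβ j _ (Or.inl hj), hβ j _ (Or.inl hj), hx j hj]
    simp
  simp only [perRow_wvec hnN hband hx]
  rw [← Finset.sum_product' (f := fun s (q : ℕ) =>
    ‖((wt n (clampPos N n s + q - s) : ℝ) : ℂ) • triRow β z x (clampPos N n s + q)
      + (lowerErr β n (clampPos N n s) s t x q + upperErr β n (clampPos N n s) s t x q)‖ ^ 2)]
  have hmain : ∑ a ∈ Finset.Icc (-(n : ℤ)) N ×ˢ Finset.range n,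
      ‖((wt n (clampPos N n a.1 + a.2 - a.1) : ℝ) : ℂ) • triRow β z x (clampPos N n a.1 + a.2)‖ ^ 2
        ≤ (δ * √S) ^ 2 := by
    rw [Finset.sum_product, mul_pow, Real.sq_sqrt hS0]
    calc _ ≤ ∑ s ∈ Finset.Icc (-(n : ℤ)) N, ∑ j ∈ Finset.Ico (0 : ℤ) N,
          wt n (j - s) ^ 2 * ‖triRow β z x j‖ ^ 2 := by
          refine Finset.sum_le_sum fun s _ => ?_
          refine le_trans (le_of_eq ?_) (sum_window_le
            (fun j => wt n (j - s) ^ 2 * ‖triRow β z x j‖ ^ 2) (fun j => by positivity) N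
            (fun j hj => by simp [htri j hj]) (clampPos N n s) n)
          refine Finset.sum_congr rfl fun q _ => ?_
          rw [norm_smul, Complex.norm_real, Real.norm_eq_abs, mul_pow, sq_abs]
      _ = S * ∑ j ∈ Finset.Ico (0 : ℤ) N, ‖triRow β z x j‖ ^ 2 :=
          sum_translates_mul (fun j => wt n j ^ 2) (fun j => ‖triRow β z x j‖ ^ 2) n N
            fun j hj => by rw [wt_eq_zero (by omega), zero_pow two_ne_zero]
      _ ≤ δ ^ 2 * S := by
          rw [mul_comm]
          gcongr
  have hlow : ∑ a ∈ Finset.Icc (-(n : ℤ)) N ×ˢ Finset.range n,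
      ‖lowerErr β n (clampPos N n a.1) a.1 t x a.2‖ ^ 2 ≤ (2 * rl * σ * √S) ^ 2 := by
    rw [Finset.sum_product]
    refine (Finset.sum_le_sum fun s _ =>
      sum_sq_norm_lowerErr_le hn hβ hrl hx ht s).trans (le_of_eq ?_)
    rw [← Finset.mul_sum, sum_translates_mul (dwt n) (fun j => ‖x j‖ ^ 2) n N
      (fun j hj => dwt_eq_zero (by omega)), hx1, sum_dwt hn, mul_pow _ √S, Real.sq_sqrt hS0]
    ring
  have hup : ∑ a ∈ Finset.Icc (-(n : ℤ)) N ×ˢ Finset.range n,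
      ‖upperErr β n (clampPos N n a.1) a.1 t x a.2‖ ^ 2 ≤ (2 * ru * σ * √S) ^ 2 := by
    rw [Finset.sum_product]
    refine (Finset.sum_le_sum fun s _ =>
      sum_sq_norm_upperErr_le hn hβ hru hx ht s).trans (le_of_eq ?_)
    have hshift : ∑ j ∈ Finset.Icc (-1 : ℤ) n, dwt n (j - 1)
        = ∑ j ∈ Finset.Icc (-1 : ℤ) n, dwt n j := by
      have h := sum_translates (dwt n) n (n + 1) (fun j hj => dwt_eq_zero (by omega))
        (j := n) (by push_cast; omega)
      have h' := sum_translates (fun j => dwt n (j - 1)) n (n + 1)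
        (fun j hj => dwt_eq_zero (by omega)) (j := n) (by push_cast; omega)
      rw [← h, ← h']
      refine Finset.sum_bij_ne_zero (fun s _ _ => s + 1) ?_ ?_ ?_ ?_
      · intro s hs h0
        by_contra hc
        refine h0 (dwt_eq_zero ?_)
        simp only [Finset.mem_Icc] at *
        push_cast at *
        omega
      · intro s _ _ s' _ _ hss
        omega
      · intro s hs h0
        refine ⟨s - 1, ?_, ?_, by ring⟩
        · by_contra hc
          refine h0 (dwt_eq_zero ?_)
          simp only [Finset.mem_Icc] at *
          push_cast at *
          omega
        · rwa [show (n : ℤ) - (s - 1) - 1 = n - s by ring]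
      · intro s _ _
        congr 1
        ring
    rw [← Finset.mul_sum, sum_translates_mul (fun j => dwt n (j - 1)) (fun j => ‖x j‖ ^ 2) n N
      (fun j hj => dwt_eq_zero (by omega)), hshift, hx1, sum_dwt hn, mul_pow _ √S,
      Real.sq_sqrt hS0]
    ring
  refine (sum_norm_add_sq_le _ _ _ (by positivity) (by positivity) hmain
    (sum_norm_add_sq_le _ _ _ (by positivity) (by positivity) hlow hup)).trans (le_of_eq ?_)
  rw [← Real.sq_sqrt hS0, Real.sqrt_sq (Real.sqrt_nonneg S)]
  ring

end Windows

section Blocks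

lemma bddAbove_opNorm_set {ι κ : Type*} [Fintype ι] [Fintype κ] [DecidableEq κ]
    (F : Matrix ι κ ℂ) : BddAbove {y : ℝ | ∃ x : EuclideanSpace ℂ κ, ‖x‖ = 1 ∧
      y = ‖Matrix.toEuclideanLin F x‖} := by
  refine ⟨‖LinearMap.toContinuousLinearMap (Matrix.toEuclideanLin F)‖, ?_⟩
  rintro _ ⟨x, hx, rfl⟩
  simpa [hx] using (LinearMap.toContinuousLinearMap (Matrix.toEuclideanLin F)).le_opNorm x

lemma opNorm_nonneg {ι κ : Type*} [Fintype ι] [Fintype κ] [DecidableEq κ]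
    (F : Matrix ι κ ℂ) : 0 ≤ opNorm F := by
  refine Real.sSup_nonneg ?_
  rintro _ ⟨x, -, rfl⟩
  exact norm_nonneg _

lemma norm_inv_norm_smul {κ : Type*} [Fintype κ] {x : EuclideanSpace ℂ κ} (hx : x ≠ 0) :
    ‖((‖x‖⁻¹ : ℝ) : ℂ) • x‖ = 1 := by
  rw [norm_smul, Complex.norm_real, norm_inv, norm_norm, inv_mul_cancel₀ (norm_ne_zero_iff.2 hx)]

lemma norm_toEuclideanLin_inv_norm_smul {ι κ : Type*} [Fintype ι] [Fintype κ] [DecidableEq κ]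
    (F : Matrix ι κ ℂ) (x : EuclideanSpace ℂ κ) :
    ‖Matrix.toEuclideanLin F (((‖x‖⁻¹ : ℝ) : ℂ) • x)‖ = ‖x‖⁻¹ * ‖Matrix.toEuclideanLin F x‖ := by
  rw [map_smul, norm_smul, Complex.norm_real, norm_inv, norm_norm]

lemma norm_toEuclideanLin_le {ι κ : Type*} [Fintype ι] [Fintype κ] [DecidableEq κ]
    (F : Matrix ι κ ℂ) (x : EuclideanSpace ℂ κ) :
    ‖Matrix.toEuclideanLin F x‖ ≤ opNorm F * ‖x‖ := by
  rcases eq_or_ne x 0 with rfl | hx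
  · simp
  have hpos : 0 < ‖x‖ := norm_pos_iff.2 hx
  have h := le_csSup (bddAbove_opNorm_set F) ⟨_, norm_inv_norm_smul hx, rfl⟩
  rw [norm_toEuclideanLin_inv_norm_smul, inv_mul_le_iff₀ hpos, mul_comm] at h
  exact h

lemma sval_mul_norm_le {ι κ : Type*} [Fintype ι] [Fintype κ] [DecidableEq κ]
    (F : Matrix ι κ ℂ) (x : EuclideanSpace ℂ κ) :
    sval F * ‖x‖ ≤ ‖Matrix.toEuclideanLin F x‖ := by
  rcases eq_or_ne x 0 with rfl | hx
  · simp
  have hpos : 0 < ‖x‖ := norm_pos_iff.2 hx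
  have hbdd : BddBelow {y : ℝ | ∃ x : EuclideanSpace ℂ κ, ‖x‖ = 1 ∧
      y = ‖Matrix.toEuclideanLin F x‖} := by
    refine ⟨0, ?_⟩
    rintro _ ⟨x, -, rfl⟩
    exact norm_nonneg _
  have h := csInf_le hbdd ⟨_, norm_inv_norm_smul hx, rfl⟩
  rw [norm_toEuclideanLin_inv_norm_smul, le_inv_mul_iff₀ hpos, mul_comm] at h
  exact h

lemma exists_norm_lt_of_sval_lt {ι κ : Type*} [Fintype ι] [Fintype κ] [DecidableEq κ] [Nonempty κ]
    {F : Matrix ι κ ℂ} {c : ℝ} (h : sval F < c) :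
    ∃ x : EuclideanSpace ℂ κ, ‖x‖ = 1 ∧ ‖Matrix.toEuclideanLin F x‖ < c := by
  obtain ⟨e, he⟩ := exists_norm_eq (EuclideanSpace ℂ κ) zero_le_one
  have hset : {y : ℝ | ∃ x : EuclideanSpace ℂ κ, ‖x‖ = 1 ∧
      y = ‖Matrix.toEuclideanLin F x‖}.Nonempty := ⟨_, e, he, rfl⟩
  obtain ⟨_, ⟨x, hx, rfl⟩, hlt⟩ := exists_lt_of_csInf_lt hset h
  exact ⟨x, hx, hlt⟩

variable {p : ℕ}

/-- The `i`-th block of a block vector. -/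
def blockVec {n : ℕ} (X : EuclideanSpace ℂ ((_ : Fin n) × Fin p)) (i : Fin n) :
    EuclideanSpace ℂ (Fin p) := WithLp.toLp 2 fun c => X ⟨i, c⟩

lemma norm_sq_eq_sum_blockVec {n : ℕ} (X : EuclideanSpace ℂ ((_ : Fin n) × Fin p)) :
    ‖X‖ ^ 2 = ∑ i, ‖blockVec X i‖ ^ 2 := by
  simp only [EuclideanSpace.norm_sq_eq, Fintype.sum_sigma, blockVec]

lemma blockVec_toEuclideanLin {n : ℕ}
    (F : Matrix ((_ : Fin n) × Fin p) ((_ : Fin n) × Fin p) ℂ)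
    (X : EuclideanSpace ℂ ((_ : Fin n) × Fin p)) (i : Fin n) :
    blockVec (Matrix.toEuclideanLin F X) i
      = ∑ j, Matrix.toEuclideanLin (Matrix.of fun c d => F ⟨i, c⟩ ⟨j, d⟩) (blockVec X j) := by
  ext c
  simp [blockVec, Matrix.toLpLin_apply, Matrix.mulVec, dotProduct, Fintype.sum_sigma]

lemma blockVec_toEuclideanLin_sub_smul_one {n : ℕ}
    (F : Matrix ((_ : Fin n) × Fin p) ((_ : Fin n) × Fin p) ℂ) (z : ℂ)
    (X : EuclideanSpace ℂ ((_ : Fin n) × Fin p)) (i : Fin n) :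
    blockVec (Matrix.toEuclideanLin (F - z • 1) X) i
      = ∑ j, Matrix.toEuclideanLin (Matrix.of fun c d => F ⟨i, c⟩ ⟨j, d⟩) (blockVec X j)
        - z • blockVec X i := by
  rw [← blockVec_toEuclideanLin, map_sub, map_smul]
  ext c
  simp [blockVec, Matrix.toLpLin_apply]

variable {N : ℕ} (a : Fin N → Fin N → Matrix (Fin p) (Fin p) ℂ)

/-- The blocks of the tridiagonal part as linear maps, extended by zero. -/
def triMap (i j : ℤ) : EuclideanSpace ℂ (Fin p) →ₗ[ℂ] EuclideanSpace ℂ (Fin p) :=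
  Matrix.toEuclideanLin (bTriExt a i j)

lemma triMap_eq_zero_of_far (i j : ℤ) (h : 1 < |i - j|) : triMap a i j = 0 := by
  rw [triMap, bTriExt, dif_neg (fun hc => absurd hc.2.2.2.2 (not_le.2 h)), map_zero]

lemma triMap_eq_zero_of_outside (i j : ℤ)
    (h : ¬(0 ≤ i ∧ i < (N : ℤ)) ∨ ¬(0 ≤ j ∧ j < (N : ℤ))) : triMap a i j = 0 := by
  rw [triMap, bTriExt, dif_neg (by tauto), map_zero]

lemma rL_nonneg : 0 ≤ rL (m := fun _ : Fin N => p) a := by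
  refine Real.sSup_nonneg ?_
  rintro _ ⟨i, j, -, rfl⟩
  exact opNorm_nonneg _

lemma rU_nonneg : 0 ≤ rU (m := fun _ : Fin N => p) a := by
  refine Real.sSup_nonneg ?_
  rintro _ ⟨i, j, -, rfl⟩
  exact opNorm_nonneg _

lemma bddAbove_opNorm_blocks (P : Fin N → Fin N → Prop) :
    BddAbove {y : ℝ | ∃ i j : Fin N, P i j ∧ y = opNorm (a i j)} := by
  refine ((Set.finite_range fun ij : Fin N × Fin N => opNorm (a ij.1 ij.2)).subset ?_).bddAbove
  rintro _ ⟨i, j, -, rfl⟩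
  exact ⟨(i, j), rfl⟩

lemma norm_triMap_lower_le (i : ℤ) (v : EuclideanSpace ℂ (Fin p)) :
    ‖triMap a i (i - 1) v‖ ≤ rL (m := fun _ : Fin N => p) a * ‖v‖ := by
  unfold triMap bTriExt
  split_ifs with h
  · refine (norm_toEuclideanLin_le _ _).trans ?_
    gcongr
    exact le_csSup (bddAbove_opNorm_blocks a fun i j => (j : ℕ) + 1 = i)
      ⟨_, _, by simp only; omega, rfl⟩
  · simpa using mul_nonneg (rL_nonneg a) (norm_nonneg v)

lemma norm_triMap_upper_le (i : ℤ) (v : EuclideanSpace ℂ (Fin p)) :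
    ‖triMap a i (i + 1) v‖ ≤ rU (m := fun _ : Fin N => p) a * ‖v‖ := by
  unfold triMap bTriExt
  split_ifs with h
  · refine (norm_toEuclideanLin_le _ _).trans ?_
    gcongr
    exact le_csSup (bddAbove_opNorm_blocks a fun i j => (i : ℕ) + 1 = j)
      ⟨_, _, by simp only; omega, rfl⟩
  · simpa using mul_nonneg (rU_nonneg a) (norm_nonneg v)

/-- The blocks of a block vector, extended by zero. -/
def extVec (X : EuclideanSpace ℂ ((_ : Fin N) × Fin p)) (j : ℤ) : EuclideanSpace ℂ (Fin p) :=
  if h : 0 ≤ j ∧ j < (N : ℤ) then blockVec X ⟨j.toNat, by omega⟩ else 0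

lemma extVec_natCast (X : EuclideanSpace ℂ ((_ : Fin N) × Fin p)) (i : Fin N) :
    extVec X (i : ℕ) = blockVec X i := by
  rw [extVec, dif_pos ⟨by omega, by have := i.isLt; omega⟩]
  rfl

lemma sum_univ_fin_eq_sum_Ico {M : Type*} [AddCommMonoid M] (f : ℤ → M) :
    ∑ i : Fin N, f (i : ℕ) = ∑ j ∈ Finset.Ico (0 : ℤ) N, f j := by
  have h := sum_range_add_eq_sum_Ico f 0 N
  simp only [zero_add] at h
  rw [← h, Finset.sum_range]

lemma sum_sq_norm_extVec (X : EuclideanSpace ℂ ((_ : Fin N) × Fin p)) :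
    ∑ j ∈ Finset.Ico (0 : ℤ) N, ‖extVec X j‖ ^ 2 = ‖X‖ ^ 2 := by
  rw [← sum_univ_fin_eq_sum_Ico fun j => ‖extVec X j‖ ^ 2, norm_sq_eq_sum_blockVec]
  simp only [extVec_natCast]

lemma triRow_extVec (z : ℂ) (X : EuclideanSpace ℂ ((_ : Fin N) × Fin p)) (i : Fin N) :
    triRow (triMap a) z (extVec X) (i : ℕ) = blockVec (Matrix.toEuclideanLin
      (blockMat (fun _ : Fin N => p) (triPart (m := fun _ : Fin N => p) a) - z • 1) X) i := by
  rw [blockVec_toEuclideanLin_sub_smul_one, triRow, extVec_natCast,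
    ← extVec_natCast X i,
    ← sum_window_eq_three (fun j => triMap a (i : ℕ) j (extVec X j)) (i : ℕ) 0 N
      (fun j hj => by rw [triMap_eq_zero_of_far a _ _ hj]; rfl)
      (fun j hj => by rw [triMap_eq_zero_of_outside a _ _ (Or.inr (by omega))]; rfl),
    Finset.sum_range]
  congr 1
  refine Finset.sum_congr rfl fun j _ => ?_
  rw [zero_add, extVec_natCast, triMap]
  congr 2
  ext c d
  have hi := i.isLt
  have hj := j.isLt
  simp only [bTriExt, Matrix.of_apply, blockMat, triPart]
  by_cases h : |((i : ℕ) : ℤ) - ((j : ℕ) : ℤ)| ≤ 1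
  · rw [dif_pos ⟨by omega, by omega, by omega, by omega, h⟩, if_pos h]
    rfl
  · rw [dif_neg (by tauto), if_neg h]

lemma perRow_eq_blockVec {n : ℕ} (hn : 1 ≤ n) (k : ℤ) (t z : ℂ)
    (v : ℤ → EuclideanSpace ℂ (Fin p)) (V : EuclideanSpace ℂ ((_ : Fin n) × Fin p))
    (hV : ∀ r : Fin n, blockVec V r = v (k + (r : ℕ))) (q : Fin n) :
    perRow (triMap a) n k t z v q
      = blockVec (Matrix.toEuclideanLin (Bper a n k t - z • 1) V) q := by
  have hblock : ∀ r : Fin n, (Matrix.of fun c d => Bper a n k t ⟨q, c⟩ ⟨r, d⟩)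
      = bTriExt a (k + (q : ℕ)) (k + (r : ℕ))
        + (if (q : ℕ) = 0 ∧ (r : ℕ) = n - 1 then t • bTriExt a (k + n) (k + n - 1) else 0)
        + (if (q : ℕ) = n - 1 ∧ (r : ℕ) = 0 then
            (starRingEnd ℂ) t • bTriExt a (k - 1) k else 0) := fun r => rfl
  have hlin : ∀ r : Fin n, Matrix.toEuclideanLin (Matrix.of fun c d => Bper a n k t ⟨q, c⟩ ⟨r, d⟩)
        (blockVec V r)
      = triMap a (k + (q : ℕ)) (k + (r : ℕ)) (v (k + (r : ℕ)))
        + (if (r : ℕ) = n - 1 then (if (q : ℕ) = 0 then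
            t • triMap a (k + n) (k + n - 1) (v (k + (r : ℕ))) else 0) else 0)
        + (if (r : ℕ) = 0 then (if (q : ℕ) = n - 1 then
            (starRingEnd ℂ) t • triMap a (k - 1) k (v (k + (r : ℕ))) else 0) else 0) := by
    intro r
    rw [hblock, hV, map_add, map_add, LinearMap.add_apply, LinearMap.add_apply]
    unfold triMap
    congr 1
    · congr 1
      split_ifs <;> simp_all
    · split_ifs <;> simp_all
  rw [blockVec_toEuclideanLin_sub_smul_one, hV, Finset.sum_congr rfl fun r _ => hlin r,
    Finset.sum_add_distrib, Finset.sum_add_distrib, perRow, Finset.sum_range]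
  congr 1
  congr 1
  · congr 1
    rw [← Finset.sum_range (fun r : ℕ => if r = n - 1 then (if (q : ℕ) = 0 then
      t • triMap a (k + n) (k + n - 1) (v (k + r)) else 0) else 0), Finset.sum_ite_eq',
      if_pos (Finset.mem_range.2 (by omega : n - 1 < n)), show k + ((n - 1 : ℕ) : ℤ) = k + n - 1 by omega]
  · rw [← Finset.sum_range (fun r : ℕ => if r = 0 then (if (q : ℕ) = n - 1 then
      (starRingEnd ℂ) t • triMap a (k - 1) k (v (k + r)) else 0) else 0), Finset.sum_ite_eq',
      if_pos (Finset.mem_range.2 (by omega : 0 < n)), Nat.cast_zero, add_zero]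

/-- A uniform lower bound `η` for the windows bounds the residual of every unit vector from
below. -/
lemma le_residual_of_forall_le_sval {n : ℕ} (hn : 1 ≤ n) (hnN : n ≤ N) {t : ℂ} (ht : ‖t‖ = 1)
    (z : ℂ) {η δ : ℝ} (hη : 0 ≤ η) (hδ : 0 ≤ δ)
    (hwin : ∀ k : Fin (N - n + 1), η ≤ sval (Bper a n (k : ℕ) t - z • 1))
    {X : EuclideanSpace ℂ ((_ : Fin N) × Fin p)} (hX : ‖X‖ = 1)
    (hres : ‖Matrix.toEuclideanLin
      (blockMat (fun _ : Fin N => p) (triPart (m := fun _ : Fin N => p) a) - z • 1) X‖ ≤ δ) :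
    η ≤ δ + 2 * rA (m := fun _ : Fin N => p) a * Real.sin (π / (2 * n)) := by
  set x := extVec X with hxdef
  have hx : ∀ j, ¬(0 ≤ j ∧ j < (N : ℤ)) → x j = 0 := fun j hj => dif_neg hj
  have hx1 : ∑ j ∈ Finset.Ico (0 : ℤ) N, ‖x j‖ ^ 2 = 1 := by
    rw [sum_sq_norm_extVec, hX, one_pow]
  have hres' : ∑ j ∈ Finset.Ico (0 : ℤ) N, ‖triRow (triMap a) z x j‖ ^ 2 ≤ δ ^ 2 := by
    rw [← sum_univ_fin_eq_sum_Ico fun j => ‖triRow (triMap a) z x j‖ ^ 2]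
    simp only [hxdef, triRow_extVec]
    rw [← norm_sq_eq_sum_blockVec]
    gcongr
  have hupper := sum_sq_norm_perRow_le hn hnN (triMap_eq_zero_of_far a)
    (triMap_eq_zero_of_outside a) (rL_nonneg a) (rU_nonneg a) (norm_triMap_lower_le a)
    (norm_triMap_upper_le a) hx ht z hx1 hδ hres'
  have hlower : ∀ s : ℤ, η ^ 2 * ∑ j ∈ Finset.Ico (0 : ℤ) N, wt n (j - s) ^ 2 * ‖x j‖ ^ 2
      ≤ ∑ q ∈ Finset.range n,
        ‖perRow (triMap a) n (clampPos N n s) t z (wvec n s x) q‖ ^ 2 := by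
    intro s
    set k := clampPos N n s with hk
    have hk0 : 0 ≤ k ∧ k + n ≤ N := by
      unfold clampPos at hk
      omega
    set V : EuclideanSpace ℂ ((_ : Fin n) × Fin p) :=
      WithLp.toLp 2 fun rc => wvec n s x (k + (rc.1 : ℕ)) rc.2 with hVdef
    have hV : ∀ r : Fin n, blockVec V r = wvec n s x (k + (r : ℕ)) := fun r => rfl
    have hnormV : ‖V‖ ^ 2 = ∑ j ∈ Finset.Ico (0 : ℤ) N, wt n (j - s) ^ 2 * ‖x j‖ ^ 2 := by
      have hw : ∀ j, ‖wvec n s x j‖ ^ 2 = wt n (j - s) ^ 2 * ‖x j‖ ^ 2 := by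
        intro j
        rw [wvec, norm_smul, Complex.norm_real, Real.norm_eq_abs, mul_pow, sq_abs]
      simp only [norm_sq_eq_sum_blockVec, hV]
      rw [← Finset.sum_range (fun r : ℕ => ‖wvec n s x (k + r)‖ ^ 2),
        sum_range_add_eq_sum_Ico (fun j => ‖wvec n s x j‖ ^ 2)]
      simp only [← hw]
      apply sum_eq_sum_of_support
      · intro j hj
        rw [wvec_eq_zero hnN hx (by simpa using hj), norm_zero, zero_pow two_ne_zero]
      · intro j hj
        rw [wvec, hx j (by simpa using hj), smul_zero, norm_zero, zero_pow two_ne_zero]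
    have hkwin := hwin ⟨k.toNat, by omega⟩
    have hkcast : ((k.toNat : ℕ) : ℤ) = k := Int.toNat_of_nonneg hk0.1
    simp only [hkcast] at hkwin
    have hle : η * ‖V‖ ≤ ‖Matrix.toEuclideanLin (Bper a n k t - z • 1) V‖ :=
      (mul_le_mul_of_nonneg_right hkwin (norm_nonneg V)).trans (sval_mul_norm_le _ V)
    rw [← hnormV, Finset.sum_range, ← mul_pow]
    simp only [perRow_eq_blockVec a hn k t z _ V hV]
    rw [← norm_sq_eq_sum_blockVec]
    gcongr
  have hsum : η ^ 2 * ∑ j ∈ Finset.Icc (-1 : ℤ) n, wt n j ^ 2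
      ≤ ∑ s ∈ Finset.Icc (-(n : ℤ)) N, ∑ q ∈ Finset.range n,
        ‖perRow (triMap a) n (clampPos N n s) t z (wvec n s x) q‖ ^ 2 := by
    refine le_trans (le_of_eq ?_) (Finset.sum_le_sum fun s _ => hlower s)
    rw [← Finset.mul_sum, sum_translates_mul (fun j => wt n j ^ 2) (fun j => ‖x j‖ ^ 2) n N
      (fun j hj => by rw [wt_eq_zero (by omega), zero_pow two_ne_zero]), hx1, mul_one]
  have hsq := le_of_mul_le_mul_right (hsum.trans hupper) (sum_wt_sq_pos hn)
  refine (sq_le_sq₀ hη ?_).1 hsq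
  exact add_nonneg hδ (mul_nonneg (mul_nonneg zero_le_two (add_nonneg (rL_nonneg a) (rU_nonneg a)))
    (sin_pi_div_two_mul_nonneg hn))

end Blocks

end SpecIncl

open SpecIncl in
/-- **Theorem 1.2 (the π-method inclusion sets).** For every ε ≥ 0,
n ∈ {1,…,N−1}, and t on the unit circle: `Spec_ε A ⊆ Π^{n,t}_ε(A)`;
in particular (taking ε = 0) `Spec A ⊆ Π^{n,t}_0(A)`. -/
theorem pi_method_inclusion {N p : ℕ} (hN : 1 < N) (hp : 0 < p)
    (a : Fin N → Fin N → Matrix (Fin p) (Fin p) ℂ)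
    (ε : ℝ) (hε : 0 ≤ ε) (n : ℕ) (hn : 1 ≤ n) (hnN : n ≤ N - 1)
    (t : ℂ) (ht : ‖t‖ = 1) :
    pspec ε (blockMat (fun _ : Fin N => p) a) ⊆ PiMethod a n t ε := by
  intro z hz
  have hne : Nonempty ((_ : Fin N) × Fin p) := ⟨⟨⟨0, by omega⟩, ⟨0, hp⟩⟩⟩
  by_contra hcon
  simp only [PiMethod, Set.mem_iUnion, pspec, Set.mem_ofPred_eq, not_exists, not_le] at hcon hz
  obtain ⟨k₀, hk₀⟩ := Finite.exists_min fun k : Fin (N - n + 1) =>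
    sval (Bper a n ((k : ℕ) : ℤ) t - z • 1)
  set η := sval (Bper a n ((k₀ : ℕ) : ℤ) t - z • 1) with hη
  set c := opNorm (blockMat (fun _ : Fin N => p) (remPart (m := fun _ : Fin N => p) a)) with hc
  have hgap := hcon k₀
  rw [← hη, epsPer, ← hc] at hgap
  have hη0 : 0 ≤ η := by
    refine Real.sInf_nonneg ?_
    rintro _ ⟨x, -, rfl⟩
    exact norm_nonneg _
  set σ := 2 * rA (m := fun _ : Fin N => p) a * Real.sin (Real.pi / (2 * (n : ℝ))) with hσ
  obtain ⟨X, hX, hXlt⟩ := exists_norm_lt_of_sval_lt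
    (show sval (blockMat (fun _ : Fin N => p) a - z • 1) < η - σ - c by linarith)
  have hsplit : blockMat (fun _ : Fin N => p) (triPart (m := fun _ : Fin N => p) a) - z • 1
      = (blockMat (fun _ : Fin N => p) a - z • 1)
        - blockMat (fun _ : Fin N => p) (remPart (m := fun _ : Fin N => p) a) := by
    rw [sub_right_comm]
    congr 1
    ext i j
    simp only [blockMat, triPart, remPart, Matrix.sub_apply]
    split_ifs <;> simp
  have hrem := norm_toEuclideanLin_le
    (blockMat (fun _ : Fin N => p) (remPart (m := fun _ : Fin N => p) a)) X
  rw [hX, mul_one, ← hc] at hrem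
  have hres : ‖Matrix.toEuclideanLin
      (blockMat (fun _ : Fin N => p) (triPart (m := fun _ : Fin N => p) a) - z • 1) X‖
      < η - σ := by
    rw [hsplit, map_sub, LinearMap.sub_apply]
    refine (norm_sub_le _ _).trans_lt ?_
    linarith
  have := le_residual_of_forall_le_sval a hn (by omega) ht z hη0 (norm_nonneg _) hk₀ hX le_rfl
  rw [← hσ] at this
  linarith
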